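/- Degree-one vanishing: the meromorphic continuation of K(α) = ∫_{ℝ₊ⁿ} t^{α̃}/(Σ_{a∈A} P_a t^{ã})^{α₀} dt/t vanishes whenever α₀ ∈ ℤ_{≤0} (away from its poles), i.e., K has zeros along the hyperplanes α₀ = 0, −1, −2, .... -/

import Mathlib

open MeasureTheory

/-- The integrand `t^{α̃} / ((Σ_{a∈A} P_a t^{ã})^{α₀} · t₁⋯t_n)` (the factor
`1/(t₁⋯t_n)` accounts for the measure `dt₁/t₁ ⋯ dt_n/t_n`). -/
noncomputable def toricIntegrand (n : ℕ) (A : Finset (Fin n → ℤ))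
    (P : (Fin n → ℤ) → ℝ) (α0 : ℂ) (α : Fin n → ℂ) (t : Fin n → ℝ) : ℂ :=
  (∏ i, (t i : ℂ) ^ (α i)) /
    ((((∑ a ∈ A, P a * ∏ i, t i ^ (a i)) : ℝ) : ℂ) ^ α0 * ∏ i, (t i : ℂ))

/-- The cone `C_A ⊆ ℝ^{n+1}` generated by the points `(1, ã)` for `ã ∈ A`. -/
def coneA (n : ℕ) (A : Finset (Fin n → ℤ)) : Set (ℝ × (Fin n → ℝ)) :=
  {x | ∃ c : (Fin n → ℤ) → ℝ, (∀ a, 0 ≤ c a) ∧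
    x = ∑ a ∈ A, c a • (((1 : ℝ), fun i => (a i : ℝ)) : ℝ × (Fin n → ℝ))}

/-- The (generalized Feynman) integral `K(α)` over the positive orthant. -/
noncomputable def Kint (n : ℕ) (A : Finset (Fin n → ℤ)) (P : (Fin n → ℤ) → ℝ)
    (α0 : ℂ) (α : Fin n → ℂ) : ℂ :=
  ∫ t in {t : Fin n → ℝ | ∀ i, 0 < t i}, toricIntegrand n A P α0 α t

/-- The candidate pole set of the continuation of `K` (the `-Σ` translates of the
facet hyperplanes). -/
def poleSet (n : ℕ) (A : Finset (Fin n → ℤ)) (W : Finset (ℤ × (Fin n → ℤ))) :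
    Set (ℂ × (Fin n → ℂ)) :=
  {α | ∃ w ∈ W, ∃ m ∈ AddSubmonoid.closure
      ((fun a : Fin n → ℤ => ((1 : ℤ), a)) '' (A : Set (Fin n → ℤ))),
    (w.1 : ℂ) * α.1 + ∑ i, (w.2 i : ℂ) * α.2 i =
      -(((w.1 * m.1 + ∑ i, w.2 i * m.2 i : ℤ)) : ℂ)}

/-- The set of points where each functional `ℓ i` has real part greater than `-N i`. -/
def shiftedTube {E ι : Type*} [NormedAddCommGroup E] [NormedSpace ℂ E] (ℓ : ι → E →L[ℂ] ℂ)
    (N : ι → ℕ) : Set E :=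
  {x | ∀ i, -(N i : ℝ) < (ℓ i x).re}

/-- `H` is analytic on the shifted tube away from `Z`, and satisfies there the contiguity
relations `ℓ i x * H x = ∑ a, ℓ i (e a) * c a * H (x + e a)`. -/
structure IsContiguous {E ι σ : Type*} [NormedAddCommGroup E] [NormedSpace ℂ E]
    (ℓ : ι → E →L[ℂ] ℂ) (A : Finset σ) (e : σ → E) (c : σ → ℂ) (Z : Set E) (N : ι → ℕ)
    (H : E → ℂ) : Prop where
  analytic : AnalyticOnNhd ℂ H (shiftedTube ℓ N ∩ Zᶜ)
  contiguity : ∀ x ∈ shiftedTube ℓ N ∩ Zᶜ, ∀ i,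
    ℓ i x * H x = ∑ a ∈ A, ℓ i (e a) * c a * H (x + e a)

section Continuation

variable {E ι σ : Type*} [NormedAddCommGroup E] [NormedSpace ℂ E] {ℓ : ι → E →L[ℂ] ℂ}
  {A : Finset σ} {e : σ → E} {c : σ → ℂ} {Z : Set E} {d : ι → σ → ℕ}

lemma isOpen_shiftedTube [Finite ι] (ℓ : ι → E →L[ℂ] ℂ) (N : ι → ℕ) :
    IsOpen (shiftedTube ℓ N) := by
  simp only [shiftedTube, Set.ofPred_forall]
  exact isOpen_iInter_of_finite fun i =>
    isOpen_lt continuous_const (Complex.continuous_re.comp (ℓ i).continuous)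

lemma shiftedTube_mono {N M : ι → ℕ} (h : N ≤ M) : shiftedTube ℓ N ⊆ shiftedTube ℓ M := by
  intro x hx i
  have : (N i : ℝ) ≤ M i := by exact_mod_cast h i
  linarith [hx i]

lemma IsContiguous.exists_step [Finite ι] [DecidableEq ι] (hd : ∀ i, ∀ a ∈ A, ℓ i (e a) = d i a)
    (hZ : IsClosed Z) (hZℓ : ∀ i x, ℓ i x = 0 → x ∈ Z)
    (hZe : ∀ a ∈ A, ∀ x, x + e a ∈ Z → x ∈ Z) {N : ι → ℕ} {H : E → ℂ}
    (hH : IsContiguous ℓ A e c Z N H) (i : ι) :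
    ∃ H', IsContiguous ℓ A e c Z (N + Pi.single i 1) H' ∧ Set.EqOn H' H (shiftedTube ℓ N) := by
  classical
  have hsub : shiftedTube ℓ N ⊆ shiftedTube ℓ (N + Pi.single i 1) :=
    shiftedTube_mono (by intro j; simp)
  have hadd : ∀ a ∈ A, ∀ M : ι → ℕ, ∀ x ∈ shiftedTube ℓ M ∩ Zᶜ,
      x + e a ∈ shiftedTube ℓ M ∩ Zᶜ := by
    intro a ha M x hx
    refine ⟨fun j => ?_, fun h => hx.2 (hZe a ha x h)⟩
    have := hx.1 j
    rw [map_add, hd j a ha, Complex.add_re, Complex.natCast_re]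
    have : (0 : ℝ) ≤ d j a := by positivity
    linarith
  have hraise : ∀ a ∈ A, ℓ i (e a) ≠ 0 → ∀ x ∈ shiftedTube ℓ (N + Pi.single i 1) ∩ Zᶜ,
      x + e a ∈ shiftedTube ℓ N ∩ Zᶜ := by
    intro a ha h0 x hx
    refine ⟨fun j => ?_, (hadd a ha _ x hx).2⟩
    have h1 := hx.1 j
    rw [map_add, hd j a ha, Complex.add_re, Complex.natCast_re]
    by_cases hji : j = i
    · subst hji
      have h2 : (1 : ℝ) ≤ d j a := by
        rw [hd j a ha] at h0
        exact_mod_cast Nat.one_le_iff_ne_zero.2 (by exact_mod_cast h0)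
      simp at h1
      linarith
    · have h2 : (0 : ℝ) ≤ d j a := by positivity
      simp [hji] at h1
      linarith
  set F : E → ℂ := fun x => (ℓ i x)⁻¹ * ∑ a ∈ A, ℓ i (e a) * c a * H (x + e a) with hF
  set H' : E → ℂ := fun x => if x ∈ shiftedTube ℓ N then H x else F x with hH'
  have heq : Set.EqOn H' H (shiftedTube ℓ N) := fun x hx => if_pos hx
  have hformula : ∀ x ∈ shiftedTube ℓ (N + Pi.single i 1) ∩ Zᶜ,
      ℓ i x * H' x = ∑ a ∈ A, ℓ i (e a) * c a * H (x + e a) := by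
    intro x hx
    have h0 : ℓ i x ≠ 0 := fun h => hx.2 (hZℓ i x h)
    by_cases hxN : x ∈ shiftedTube ℓ N
    · rw [heq hxN, hH.contiguity x ⟨hxN, hx.2⟩ i]
    · rw [hH']
      simp only [hxN, if_false, hF]
      rw [mul_inv_cancel_left₀ h0]
  refine ⟨H', ⟨fun x hx => ?_, fun x hx j => ?_⟩, heq⟩
  · have h0 : ℓ i x ≠ 0 := fun h => hx.2 (hZℓ i x h)
    have hFan : AnalyticAt ℂ F x := by
      refine ((ℓ i).analyticAt x).inv h0 |>.mul
        (Finset.analyticAt_fun_sum _ fun a ha => ?_)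
      by_cases hz : ℓ i (e a) = 0
      · simp only [hz, zero_mul]
        exact analyticAt_const
      · exact analyticAt_const.mul
          (AnalyticAt.fun_comp (g := H) (f := fun y => y + e a)
            (hH.analytic _ (hraise a ha hz x hx)) (analyticAt_id.add analyticAt_const))
    refine hFan.congr ?_
    filter_upwards [((isOpen_shiftedTube ℓ _).inter hZ.isOpen_compl).mem_nhds hx] with y hy
    have h0 : ℓ i y ≠ 0 := fun h => hy.2 (hZℓ i y h)
    rw [hF, ← mul_right_inj' h0, hformula y hy]
    simp only
    rw [mul_inv_cancel_left₀ h0]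
  · have h0 : ℓ i x ≠ 0 := fun h => hx.2 (hZℓ i x h)
    have key : ∀ a ∈ A, ℓ i (e a) * c a * (ℓ j x * H (x + e a)) =
        ∑ b ∈ A, ℓ i (e a) * c a * (ℓ j (e b) * c b * H (x + e a + e b)) -
          ℓ i (e a) * c a * (ℓ j (e a) * H (x + e a)) := by
      intro a ha
      by_cases hz : ℓ i (e a) = 0
      · simp [hz]
      · rw [← Finset.mul_sum, ← hH.contiguity _ (hraise a ha hz x hx) j, map_add]
        ring
    have key' : ∀ b ∈ A, ℓ j (e b) * c b * (ℓ i x * H' (x + e b)) =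
        ∑ a ∈ A, ℓ i (e a) * c a * (ℓ j (e b) * c b * H (x + e a + e b)) -
          ℓ i (e b) * c b * (ℓ j (e b) * H (x + e b)) := by
      intro b hb
      have h1 := hformula _ (hadd b hb _ x hx)
      have h2 : ℓ i (e b) * H' (x + e b) = ℓ i (e b) * H (x + e b) := by
        by_cases hz : ℓ i (e b) = 0
        · simp [hz]
        · rw [heq (hraise b hb hz x hx).1]
      have h3 : ∑ a ∈ A, ℓ i (e a) * c a * (ℓ j (e b) * c b * H (x + e a + e b)) =
          ℓ j (e b) * c b * ∑ a ∈ A, ℓ i (e a) * c a * H (x + e b + e a) := by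
        rw [Finset.mul_sum]
        refine Finset.sum_congr rfl fun a _ => ?_
        rw [add_right_comm]
        ring
      rw [h3, ← h1, map_add]
      linear_combination (- ℓ j (e b) * c b) * h2
    rw [← mul_right_inj' h0]
    calc ℓ i x * (ℓ j x * H' x) = ℓ j x * (ℓ i x * H' x) := by ring
      _ = ∑ a ∈ A, ℓ i (e a) * c a * (ℓ j x * H (x + e a)) := by
        rw [hformula x hx, Finset.mul_sum]
        exact Finset.sum_congr rfl fun a _ => by ring
      _ = ∑ b ∈ A, ℓ j (e b) * c b * (ℓ i x * H' (x + e b)) := by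
        rw [Finset.sum_congr rfl key, Finset.sum_congr rfl key', Finset.sum_sub_distrib,
          Finset.sum_sub_distrib, Finset.sum_comm]
      _ = ℓ i x * ∑ b ∈ A, ℓ j (e b) * c b * H' (x + e b) := by
        rw [Finset.mul_sum]
        exact Finset.sum_congr rfl fun a _ => by ring

lemma IsContiguous.exists_step_one [Finite ι] (hd : ∀ i, ∀ a ∈ A, ℓ i (e a) = d i a)
    (hZ : IsClosed Z) (hZℓ : ∀ i x, ℓ i x = 0 → x ∈ Z)
    (hZe : ∀ a ∈ A, ∀ x, x + e a ∈ Z → x ∈ Z) {N : ι → ℕ} {H : E → ℂ}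
    (hH : IsContiguous ℓ A e c Z N H) :
    ∃ H', IsContiguous ℓ A e c Z (N + 1) H' ∧ Set.EqOn H' H (shiftedTube ℓ N) := by
  classical
  cases nonempty_fintype ι
  have main : ∀ s : Finset ι, ∃ H', IsContiguous ℓ A e c Z (N + ∑ i ∈ s, Pi.single i 1) H' ∧
      Set.EqOn H' H (shiftedTube ℓ N) := by
    intro s
    induction s using Finset.induction_on with
    | empty => exact ⟨H, by simpa using hH, fun _ _ => rfl⟩
    | insert i s his ih =>
      obtain ⟨H₁, h₁, heq₁⟩ := ih
      obtain ⟨H₂, h₂, heq₂⟩ := h₁.exists_step hd hZ hZℓ hZe i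
      refine ⟨H₂, ?_, fun x hx => ?_⟩
      · rwa [Finset.sum_insert his, add_comm (Pi.single i 1), ← add_assoc]
      · rw [heq₂ (shiftedTube_mono (by intro j; simp) hx), heq₁ hx]
  obtain ⟨H', h, heq⟩ := main Finset.univ
  refine ⟨H', ?_, heq⟩
  have : ∑ i : ι, (Pi.single i 1 : ι → ℕ) = 1 := Finset.univ_sum_single (1 : ι → ℕ)
  rwa [this] at h

/-- A function satisfying contiguity relations on a tube extends analytically off `Z`. -/
theorem IsContiguous.exists_continuation [Finite ι] (hd : ∀ i, ∀ a ∈ A, ℓ i (e a) = d i a)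
    (hZ : IsClosed Z) (hZℓ : ∀ i x, ℓ i x = 0 → x ∈ Z)
    (hZe : ∀ a ∈ A, ∀ x, x + e a ∈ Z → x ∈ Z) {H : E → ℂ}
    (hH : IsContiguous ℓ A e c Z 0 H) :
    ∃ G : E → ℂ, AnalyticOnNhd ℂ G Zᶜ ∧ Set.EqOn G H (shiftedTube ℓ 0) := by
  classical
  cases nonempty_fintype ι
  have step : ∀ (n : ℕ) (F : E → ℂ), ∃ F', IsContiguous ℓ A e c Z (fun _ => n) F →
      IsContiguous ℓ A e c Z (fun _ => n + 1) F' ∧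
        Set.EqOn F' F (shiftedTube ℓ (fun _ => n)) := by
    intro n F
    by_cases hF : IsContiguous ℓ A e c Z (fun _ => n) F
    · obtain ⟨F', h⟩ := hF.exists_step_one hd hZ hZℓ hZe
      exact ⟨F', fun _ => h⟩
    · exact ⟨F, fun h => absurd h hF⟩
  choose next hnext using step
  let S : ℕ → E → ℂ := fun n => Nat.rec H next n
  have hS : ∀ n, IsContiguous ℓ A e c Z (fun _ => n) (S n) := by
    intro n
    induction n with
    | zero => exact hH
    | succ n ih => exact (hnext n _ ih).1
  have hmono : ∀ {n m : ℕ}, n ≤ m →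
      shiftedTube ℓ (fun _ => n) ⊆ shiftedTube ℓ (fun _ => m) :=
    fun h => shiftedTube_mono fun _ => h
  have heq : ∀ {n m : ℕ}, n ≤ m → Set.EqOn (S m) (S n) (shiftedTube ℓ (fun _ => n)) := by
    intro n m h
    induction m, h using Nat.le_induction with
    | base => exact fun _ _ => rfl
    | succ m hm ih => exact fun x hx => ((hnext m _ (hS m)).2 (hmono hm hx)).trans (ih hx)
  have hex : ∀ x, ∃ n : ℕ, x ∈ shiftedTube ℓ (fun _ => n) := by
    intro x
    choose k hk using fun i => exists_nat_gt (-(ℓ i x).re)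
    refine ⟨∑ i, k i, fun i => ?_⟩
    have : (k i : ℝ) ≤ (∑ i, k i : ℕ) := by
      exact_mod_cast Finset.single_le_sum (f := k) (fun _ _ => Nat.zero_le _) (Finset.mem_univ i)
    linarith [hk i]
  refine ⟨fun x => S (Nat.find (hex x)) x, fun x hx => ?_, fun x hx => ?_⟩
  · obtain ⟨n, hn⟩ := hex x
    refine ((hS n).analytic x ⟨hn, hx⟩).congr ?_
    filter_upwards [(isOpen_shiftedTube ℓ _).mem_nhds hn] with y hy
    exact heq (Nat.find_min' (hex y) hy) (Nat.find_spec (hex y))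
  · exact (heq (Nat.zero_le _) hx)

end Continuation

/-- Analyticity of a Laplace-type integral `z ↦ ∫ exp (L u z)` in several variables. -/
theorem analyticAt_integral_cexp {X E : Type*} [MeasurableSpace X] {μ : Measure X}
    [NormedAddCommGroup E] [NormedSpace ℂ E] {L : X → E →L[ℂ] ℂ}
    (hL : AEStronglyMeasurable L μ) {z : E} {r : ℝ} (hr : 0 < r)
    (hint : Integrable (fun u => Real.exp ((L u z).re + r * ‖L u‖)) μ) :
    AnalyticAt ℂ (fun z => ∫ u, Complex.exp (L u z) ∂μ) z := by
  let q : (k : ℕ) → X → ContinuousMultilinearMap ℂ (fun _ : Fin k => E) ℂ := fun k u =>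
    (Complex.exp (L u z) * (k.factorial : ℂ)⁻¹) •
      (ContinuousMultilinearMap.mkPiAlgebraFin ℂ k ℂ).compContinuousLinearMap fun _ => L u
  have hLz : AEStronglyMeasurable (fun u => Complex.exp (L u z)) μ :=
    Complex.continuous_exp.comp_aestronglyMeasurable (hL.apply_continuousLinearMap z)
  have hqm : ∀ k, AEStronglyMeasurable (q k) μ := by
    intro k
    refine (hLz.mul_const _).smul ?_
    have hc : Continuous fun T : E →L[ℂ] ℂ =>
        (ContinuousMultilinearMap.mkPiAlgebraFin ℂ k ℂ).compContinuousLinearMap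
          (fun _ : Fin k => T) :=
      ((ContinuousMultilinearMap.compContinuousLinearMapContinuousMultilinear ℂ
        (fun _ : Fin k => E) (fun _ => ℂ) ℂ).cont.comp
          (continuous_pi fun _ => continuous_id)).clm_apply continuous_const
    exact hc.comp_aestronglyMeasurable hL
  have hqn : ∀ k u, ‖q k u‖ ≤ Real.exp (L u z).re * ((k.factorial : ℝ)⁻¹ * ‖L u‖ ^ k) := by
    intro k u
    rw [norm_smul, norm_mul, Complex.norm_exp, norm_inv, Complex.norm_natCast, mul_assoc]
    gcongr
    refine (ContinuousMultilinearMap.norm_compContinuousLinearMap_le _ _).trans ?_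
    simp
  have hsum : ∀ u, HasSum (fun k : ℕ => Real.exp (L u z).re *
      ((k.factorial : ℝ)⁻¹ * ‖L u‖ ^ k) * r ^ k) (Real.exp ((L u z).re + r * ‖L u‖)) := by
    intro u
    have h := (NormedSpace.exp_series_hasSum_exp' (𝕂 := ℝ) (r * ‖L u‖)).mul_left
      (Real.exp (L u z).re)
    rw [← Real.exp_eq_exp_ℝ, ← Real.exp_add] at h
    refine (congrArg (fun s => HasSum s _) (funext fun k => ?_)).mpr h
    rw [smul_eq_mul, mul_pow]
    ring
  have hqr : ∀ k u, ‖q k u‖ * r ^ k ≤ Real.exp ((L u z).re + r * ‖L u‖) := fun k u =>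
    (mul_le_mul_of_nonneg_right (hqn k u) (by positivity)).trans
      (le_hasSum (hsum u) k fun j _ => by positivity)
  have hqint : ∀ k, Integrable (q k) μ := by
    intro k
    refine (hint.mul_const (r ^ k)⁻¹).mono' (hqm k) (ae_of_all _ fun u => ?_)
    rw [← div_eq_mul_inv, le_div_iff₀ (by positivity)]
    exact hqr k u
  refine ⟨fun k => ∫ u, q k u ∂μ, ENNReal.ofReal r, ?_, by simpa using hr, ?_⟩
  · refine FormalMultilinearSeries.le_radius_of_bound _
      (∫ u, Real.exp ((L u z).re + r * ‖L u‖) ∂μ) fun k => ?_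
    rw [Real.coe_toNNReal _ hr.le]
    refine (mul_le_mul_of_nonneg_right (norm_integral_le_integral_norm _) (by positivity)).trans ?_
    rw [← integral_mul_const]
    exact integral_mono ((hqint k).norm.mul_const _) hint (hqr k)
  · intro y hy
    rw [Metric.eball_ofReal, mem_ball_zero_iff] at hy
    have happ : ∀ k, (∫ u, q k u ∂μ) (fun _ => y) = ∫ u, q k u (fun _ => y) ∂μ := fun k =>
      ContinuousMultilinearMap.integral_apply (hqint k) _
    simp_rw [happ]
    refine hasSum_integral_of_dominated_convergence
      (fun k u => Real.exp (L u z).re * ((k.factorial : ℝ)⁻¹ * ‖L u‖ ^ k) * r ^ k)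
      (fun k => (ContinuousMultilinearMap.apply ℂ (fun _ : Fin k => E) ℂ
        fun _ => y).continuous.comp_aestronglyMeasurable (hqm k))
      (fun k => ae_of_all _ fun u => ?_)
      (ae_of_all _ fun u => (hsum u).summable) ?_ (ae_of_all _ fun u => ?_)
    · refine ((q k u).le_opNorm _).trans ?_
      simp only [Finset.prod_const, Finset.card_univ, Fintype.card_fin]
      gcongr
      exact hqn k u
    · simpa only [(hsum _).tsum_eq] using hint
    · have h := (NormedSpace.exp_series_hasSum_exp' (𝕂 := ℂ) (L u y)).mul_left
        (Complex.exp (L u z))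
      rw [← Complex.exp_eq_exp_ℂ, ← Complex.exp_add, ← map_add] at h
      refine (congrArg (fun s => HasSum s _) (funext fun k => ?_)).mpr h
      simp [q, mul_assoc]

/-- The linear functional `⟨w, ·⟩` on `ℂ × ℂⁿ`. -/
noncomputable def toricPairing {n : ℕ} (w : ℤ × (Fin n → ℤ)) : ℂ × (Fin n → ℂ) →L[ℂ] ℂ :=
  (w.1 : ℂ) • ContinuousLinearMap.fst ℂ ℂ (Fin n → ℂ) +
    ∑ i, (w.2 i : ℂ) • (ContinuousLinearMap.proj i).comp (ContinuousLinearMap.snd ℂ ℂ (Fin n → ℂ))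

/-- The point `(1, a)` of `ℂ × ℂⁿ`. -/
def toricPoint {n : ℕ} (a : Fin n → ℤ) : ℂ × (Fin n → ℂ) := (1, fun i => (a i : ℂ))

/-- The polynomial `∑ P_a t^a` in logarithmic coordinates `t = exp u`. -/
noncomputable def toricSum {n : ℕ} (A : Finset (Fin n → ℤ)) (P : (Fin n → ℤ) → ℝ)
    (u : Fin n → ℝ) : ℝ :=
  ∑ a ∈ A, P a * Real.exp (∑ i, (a i : ℝ) * u i)

/-- The exponent of the toric integrand in logarithmic coordinates, linear in the parameters. -/
noncomputable def toricPhase {n : ℕ} (A : Finset (Fin n → ℤ)) (P : (Fin n → ℤ) → ℝ)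
    (u : Fin n → ℝ) : ℂ × (Fin n → ℂ) →L[ℂ] ℂ :=
  ∑ i, (u i : ℂ) • (ContinuousLinearMap.proj i).comp (ContinuousLinearMap.snd ℂ ℂ (Fin n → ℂ)) -
    (Real.log (toricSum A P u) : ℂ) • ContinuousLinearMap.fst ℂ ℂ (Fin n → ℂ)

section Toric

variable {n : ℕ} {A : Finset (Fin n → ℤ)} {P : (Fin n → ℤ) → ℝ}

lemma toricPairing_apply (w : ℤ × (Fin n → ℤ)) (z : ℂ × (Fin n → ℂ)) :
    toricPairing w z = (w.1 : ℂ) * z.1 + ∑ i, (w.2 i : ℂ) * z.2 i := by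
  simp [toricPairing]

lemma toricPairing_toricPoint (w : ℤ × (Fin n → ℤ)) (a : Fin n → ℤ) :
    toricPairing w (toricPoint a) = ((w.1 + ∑ i, w.2 i * a i : ℤ) : ℂ) := by
  simp [toricPairing_apply, toricPoint]

lemma re_toricPairing (w : ℤ × (Fin n → ℤ)) (z : ℂ × (Fin n → ℂ)) :
    (toricPairing w z).re = (w.1 : ℝ) * z.1.re + ∑ i, (w.2 i : ℝ) * (z.2 i).re := by
  simp [toricPairing_apply]

lemma toricPhase_apply (u : Fin n → ℝ) (z : ℂ × (Fin n → ℂ)) :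
    toricPhase A P u z = ∑ i, (u i : ℂ) * z.2 i - (Real.log (toricSum A P u) : ℂ) * z.1 := by
  simp [toricPhase]

lemma re_toricPhase (u : Fin n → ℝ) (z : ℂ × (Fin n → ℂ)) :
    (toricPhase A P u z).re =
      ∑ i, (z.2 i).re * u i - z.1.re * Real.log (toricSum A P u) := by
  rw [toricPhase_apply, Complex.sub_re, Complex.re_sum, Complex.re_ofReal_mul]
  simp [mul_comm]

lemma norm_toricPhase_le (u : Fin n → ℝ) :
    ‖toricPhase A P u‖ ≤ n * ‖u‖ + |Real.log (toricSum A P u)| := by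
  refine ContinuousLinearMap.opNorm_le_bound _ (by positivity) fun z => ?_
  rw [toricPhase_apply, add_mul]
  refine (norm_sub_le _ _).trans (add_le_add ((norm_sum_le _ _).trans ?_) ?_)
  · have h : ∀ i ∈ Finset.univ, ‖(u i : ℂ) * z.2 i‖ ≤ ‖u‖ * ‖z‖ := by
      intro i _
      rw [norm_mul, Complex.norm_real]
      gcongr
      · exact norm_le_pi_norm u i
      · exact (norm_le_pi_norm z.2 i).trans (norm_snd_le z)
    refine (Finset.sum_le_card_nsmul _ _ _ h).trans ?_
    simp [mul_assoc]
  · rw [norm_mul, Complex.norm_real, Real.norm_eq_abs]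
    gcongr
    exact norm_fst_le z

lemma toricSum_pos (hA : A.Nonempty) (hP : ∀ a ∈ A, 0 < P a) (u : Fin n → ℝ) :
    0 < toricSum A P u :=
  Finset.sum_pos (fun a ha => mul_pos (hP a ha) (Real.exp_pos _)) hA

lemma continuous_toricSum : Continuous (toricSum A P) := by
  unfold toricSum
  fun_prop

lemma continuous_toricPhase (hA : A.Nonempty) (hP : ∀ a ∈ A, 0 < P a) :
    Continuous (toricPhase A P) := by
  unfold toricPhase
  have h : Continuous fun u : Fin n → ℝ => Real.log (toricSum A P u) :=
    continuous_toricSum.log fun u => (toricSum_pos hA hP u).ne'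
  exact (continuous_finsetSum _ fun i _ =>
    (Complex.continuous_ofReal.comp (continuous_apply i)).smul continuous_const).sub
      ((Complex.continuous_ofReal.comp h).smul continuous_const)

/-- The toric integral in logarithmic coordinates. -/
lemma Kint_eq_integral_cexp (hA : A.Nonempty) (hP : ∀ a ∈ A, 0 < P a)
    (z : ℂ × (Fin n → ℂ)) :
    Kint n A P z.1 z.2 = ∫ u, Complex.exp (toricPhase A P u z) := by
  let φ : (Fin n → ℝ) → Fin n → ℝ := fun u i => Real.exp (u i)
  let φ' : (Fin n → ℝ) → (Fin n → ℝ) →L[ℝ] (Fin n → ℝ) := fun u =>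
    ContinuousLinearMap.pi fun i =>
      (Real.exp (u i) • ContinuousLinearMap.id ℝ ℝ).comp (ContinuousLinearMap.proj i)
  have himage : φ '' Set.univ = {t : Fin n → ℝ | ∀ i, 0 < t i} := by
    ext t
    refine ⟨?_, fun ht => ⟨fun i => Real.log (t i), trivial, funext fun i => Real.exp_log (ht i)⟩⟩
    rintro ⟨u, -, rfl⟩ i
    exact Real.exp_pos _
  have hderiv : ∀ u ∈ Set.univ, HasFDerivWithinAt φ (φ' u) Set.univ u := by
    intro u _
    refine HasFDerivAt.hasFDerivWithinAt (hasFDerivAt_pi.2 fun i => ?_)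
    have h := (ContinuousLinearMap.proj (R := ℝ) (φ := fun _ : Fin n => ℝ) i).hasFDerivAt
      (x := u) |>.exp
    exact h
  have hinj : Set.InjOn φ Set.univ := fun u _ v _ h =>
    funext fun i => Real.exp_injective (congrFun h i)
  rw [Kint, ← himage, integral_image_eq_integral_abs_det_fderiv_smul volume MeasurableSet.univ
    hderiv hinj, setIntegral_univ]
  refine integral_congr_ae (ae_of_all _ fun u => ?_)
  have hdet : (φ' u).det = ∏ i, Real.exp (u i) := by
    rw [ContinuousLinearMap.det_pi]
    simp
  have hsum : ∑ a ∈ A, P a * ∏ i, φ u i ^ (a i) = toricSum A P u := by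
    refine Finset.sum_congr rfl fun a _ => ?_
    rw [Real.exp_sum]
    congr 1
    refine Finset.prod_congr rfl fun i _ => ?_
    rw [mul_comm, Real.exp_mul, Real.rpow_intCast]
  have hne : ∏ i, (Real.exp (u i) : ℂ) ≠ 0 :=
    Finset.prod_ne_zero_iff.2 fun i _ => by exact_mod_cast (Real.exp_pos _).ne'
  have hpow : ∀ i, ((φ u i : ℝ) : ℂ) ^ z.2 i = Complex.exp (u i * z.2 i) := by
    intro i
    rw [Complex.cpow_def_of_ne_zero (by exact_mod_cast (Real.exp_pos _).ne'),
      ← Complex.ofReal_log (Real.exp_pos _).le, Real.log_exp]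
  simp only
  rw [hdet, abs_of_pos (Finset.prod_pos fun i _ => Real.exp_pos _), toricIntegrand, hsum,
    Complex.cpow_def_of_ne_zero (by exact_mod_cast (toricSum_pos hA hP u).ne'),
    ← Complex.ofReal_log (toricSum_pos hA hP u).le, Finset.prod_congr rfl fun i _ => hpow i,
    toricPhase_apply, Complex.exp_sub, Complex.exp_sum, Complex.real_smul]
  push_cast at hne ⊢
  simp only [φ, Complex.ofReal_exp]
  field_simp

lemma coneA_fst_nonneg {v : ℝ × (Fin n → ℝ)} (hv : v ∈ coneA n A) : 0 ≤ v.1 := by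
  obtain ⟨c, hc, rfl⟩ := hv
  rw [Prod.fst_sum]
  exact Finset.sum_nonneg fun a _ => by simpa using hc a

lemma coneA_phase_le (hP : ∀ a ∈ A, 0 < P a) {v : ℝ × (Fin n → ℝ)}
    (hv : v ∈ coneA n A) (u : Fin n → ℝ) :
    ∑ i, v.2 i * u i - v.1 * Real.log (toricSum A P u) ≤ v.1 * ∑ a ∈ A, |Real.log (P a)| := by
  obtain ⟨c, hc, rfl⟩ := hv
  have h1 : (∑ a ∈ A, c a • (((1 : ℝ), fun i => (a i : ℝ)) : ℝ × (Fin n → ℝ))).1 =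
      ∑ a ∈ A, c a := by simp [Prod.fst_sum]
  have h2 : ∑ i, (∑ a ∈ A, c a • (((1 : ℝ), fun i => (a i : ℝ)) : ℝ × (Fin n → ℝ))).2 i * u i =
      ∑ a ∈ A, c a * ∑ i, (a i : ℝ) * u i := by
    simp only [Prod.snd_sum, Finset.sum_apply, Prod.smul_snd, Pi.smul_apply, smul_eq_mul,
      Finset.sum_mul, Finset.mul_sum]
    rw [Finset.sum_comm]
    exact Finset.sum_congr rfl fun a _ => Finset.sum_congr rfl fun i _ => by ring
  rw [h1, h2, Finset.sum_mul, Finset.sum_mul, ← Finset.sum_sub_distrib]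
  refine Finset.sum_le_sum fun a ha => ?_
  rw [← mul_sub]
  refine mul_le_mul_of_nonneg_left ?_ (hc a)
  have hle : P a * Real.exp (∑ i, (a i : ℝ) * u i) ≤ toricSum A P u :=
    Finset.single_le_sum (f := fun a => P a * Real.exp (∑ i, (a i : ℝ) * u i))
      (fun b hb => (mul_pos (hP b hb) (Real.exp_pos _)).le) ha
  have hlog := Real.log_le_log (mul_pos (hP a ha) (Real.exp_pos _)) hle
  rw [Real.log_mul (hP a ha).ne' (Real.exp_pos _).ne', Real.log_exp] at hlog
  have habs : |Real.log (P a)| ≤ ∑ a ∈ A, |Real.log (P a)| :=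
    Finset.single_le_sum (f := fun a => |Real.log (P a)|) (fun _ _ => abs_nonneg _) ha
  linarith [neg_abs_le (Real.log (P a))]

lemma exists_add_mem_of_mem_interior {V : Type*} [NormedAddCommGroup V] {S : Set V} {x : V}
    (hx : x ∈ interior S) : ∃ ε > 0, ∀ v, ‖v‖ ≤ ε → x + v ∈ S := by
  obtain ⟨δ, hδ, hball⟩ := Metric.mem_nhds_iff.1 (mem_interior_iff_mem_nhds.1 hx)
  refine ⟨δ / 2, by positivity, fun v hv => hball ?_⟩
  rw [Metric.mem_ball, dist_eq_norm, add_sub_cancel_left]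
  linarith

lemma fst_pos_of_mem_interior_coneA {x : ℝ × (Fin n → ℝ)} (hx : x ∈ interior (coneA n A)) :
    0 < x.1 := by
  obtain ⟨ε, hε, h⟩ := exists_add_mem_of_mem_interior hx
  have := coneA_fst_nonneg (h (-ε, 0) (by simp [Prod.norm_def, abs_of_pos hε, hε.le]))
  simp at this
  linarith

lemma nonempty_of_mem_interior_coneA {x : ℝ × (Fin n → ℝ)} (hx : x ∈ interior (coneA n A)) :
    A.Nonempty := by
  rw [Finset.nonempty_iff_ne_empty]
  rintro rfl
  have h := fst_pos_of_mem_interior_coneA hx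
  obtain ⟨c, -, rfl⟩ := interior_subset hx
  simp at h

lemma integrable_exp_neg_mul_norm {κ : ℝ} (hκ : 0 < κ) :
    Integrable fun u : Fin n → ℝ => Real.exp (-(κ * ‖u‖)) := by
  have h := (integrable_one_add_norm (E := Fin n → ℝ) (μ := volume) (r := ((n + 1 : ℕ) : ℝ))
    (by simp)).const_mul (Real.exp κ * (n + 1).factorial / κ ^ (n + 1))
  refine h.mono' (by fun_prop) (ae_of_all _ fun u => ?_)
  have hpos : 0 < 1 + ‖u‖ := by positivity
  have hle := Real.pow_div_factorial_le_exp (κ * (1 + ‖u‖)) (by positivity) (n + 1)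
  rw [Real.norm_eq_abs, abs_of_pos (Real.exp_pos _), Real.rpow_neg hpos.le, Real.rpow_natCast,
    ← div_eq_mul_inv, le_div_iff₀ (by positivity), le_div_iff₀ (by positivity)]
  rw [div_le_iff₀ (by positivity), mul_pow] at hle
  calc Real.exp (-(κ * ‖u‖)) * (1 + ‖u‖) ^ (n + 1) * κ ^ (n + 1)
      = Real.exp (-(κ * ‖u‖)) * (κ ^ (n + 1) * (1 + ‖u‖) ^ (n + 1)) := by ring
    _ ≤ Real.exp (-(κ * ‖u‖)) * (Real.exp (κ * (1 + ‖u‖)) * (n + 1).factorial) := by gcongr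
    _ = Real.exp κ * (n + 1).factorial := by
      rw [← mul_assoc, ← Real.exp_add]
      ring_nf

lemma exists_integrable_exp_toricPhase (hP : ∀ a ∈ A, 0 < P a) {z : ℂ × (Fin n → ℂ)}
    (hz : ((z.1.re, fun i => (z.2 i).re) : ℝ × (Fin n → ℝ)) ∈ interior (coneA n A)) :
    ∃ r > 0, Integrable fun u : Fin n → ℝ =>
      Real.exp ((toricPhase A P u z).re + r * ‖toricPhase A P u‖) := by
  have hA := nonempty_of_mem_interior_coneA hz
  obtain ⟨ε, hε, hadd⟩ := exists_add_mem_of_mem_interior hz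
  set M : ℝ := ∑ a ∈ A, |Real.log (P a)|
  have hM : 0 ≤ M := Finset.sum_nonneg fun _ _ => abs_nonneg _
  set C : ℝ := (z.1.re + ε) * M with hC
  have hfst : ∀ s : ℝ, |s| ≤ ε → ∀ u,
      (toricPhase A P u z).re - s * Real.log (toricSum A P u) ≤ C := by
    intro s hs u
    have h := coneA_phase_le hP (hadd (s, 0) (by simpa [Prod.norm_def] using hs)) u
    simp only [Prod.fst_add, Prod.snd_add, add_zero] at h
    have h2 : (z.1.re + s) * M ≤ C := by
      rw [hC]
      gcongr
      exact (le_abs_self s).trans hs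
    rw [re_toricPhase]
    linarith
  have hsnd : ∀ (s : ℝ) (i : Fin n), |s| ≤ ε → ∀ u,
      (toricPhase A P u z).re + s * u i ≤ C := by
    intro s i hs u
    have h := coneA_phase_le hP (hadd (0, Pi.single i s)
      (by simpa [Prod.norm_def, Pi.norm_single] using hs)) u
    simp only [Prod.fst_add, Prod.snd_add, add_zero, Pi.add_apply, add_mul,
      Finset.sum_add_distrib] at h
    have h2 : ∑ j, (Pi.single i s : Fin n → ℝ) j * u j = s * u i := by
      rw [Finset.sum_eq_single i] <;> simp +contextual
    have h3 : z.1.re * M ≤ C := by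
      rw [hC]
      gcongr
      linarith
    rw [re_toricPhase]
    linarith
  have hbound_log : ∀ u, (toricPhase A P u z).re + ε * |Real.log (toricSum A P u)| ≤ C := by
    intro u
    rcases abs_cases (Real.log (toricSum A P u)) with ⟨h, -⟩ | ⟨h, -⟩ <;> rw [h]
    · linarith [hfst (-ε) (by rw [abs_neg, abs_of_pos hε]) u]
    · linarith [hfst ε (by rw [abs_of_pos hε]) u]
  have hbound_norm : ∀ u, (toricPhase A P u z).re + ε * ‖u‖ ≤ C := by
    intro u
    have hle : ‖u‖ ≤ (C - (toricPhase A P u z).re) / ε := by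
      refine (pi_norm_le_iff_of_nonneg (div_nonneg ?_ hε.le)).2 fun i => ?_
      · have := mul_nonneg hε.le (abs_nonneg (Real.log (toricSum A P u)))
        linarith [hbound_log u]
      · rw [le_div_iff₀ hε, Real.norm_eq_abs]
        rcases abs_cases (u i) with ⟨h, -⟩ | ⟨h, -⟩ <;> rw [h]
        · linarith [hsnd ε i (by rw [abs_of_pos hε]) u]
        · linarith [hsnd (-ε) i (by rw [abs_neg, abs_of_pos hε]) u]
    rw [le_div_iff₀ hε] at hle
    linarith
  refine ⟨ε / (4 * (n + 1)), by positivity, ?_⟩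
  have hcont := continuous_toricPhase hA hP
  refine ((integrable_exp_neg_mul_norm (n := n) (κ := ε / 4) (by positivity)).const_mul
    (Real.exp C)).mono' ?_ (ae_of_all _ fun u => ?_)
  · exact (Real.continuous_exp.comp ((Complex.continuous_re.comp
      (hcont.clm_apply continuous_const)).add
        (continuous_const.mul hcont.norm))).aestronglyMeasurable
  · rw [Real.norm_eq_abs, abs_of_pos (Real.exp_pos _), ← Real.exp_add, Real.exp_le_exp]
    have h1 : ε / (4 * (n + 1)) * ‖toricPhase A P u‖ ≤
        ε / 4 * (‖u‖ + |Real.log (toricSum A P u)|) := by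
      rw [div_mul_eq_mul_div, div_le_iff₀ (by positivity)]
      have h2 : ‖toricPhase A P u‖ ≤ (n + 1) * (‖u‖ + |Real.log (toricSum A P u)|) := by
        refine (norm_toricPhase_le u).trans ?_
        have := norm_nonneg u
        have : 0 ≤ (n : ℝ) * |Real.log (toricSum A P u)| := by positivity
        linarith
      calc ε * ‖toricPhase A P u‖ ≤ ε * ((n + 1) * (‖u‖ + |Real.log (toricSum A P u)|)) := by
            gcongr
        _ = _ := by ring
    have h3 : 0 ≤ ε * |Real.log (toricSum A P u)| := by positivity
    linarith [hbound_log u, hbound_norm u]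

lemma integrable_cexp_toricPhase (hP : ∀ a ∈ A, 0 < P a) {z : ℂ × (Fin n → ℂ)}
    (hz : ((z.1.re, fun i => (z.2 i).re) : ℝ × (Fin n → ℝ)) ∈ interior (coneA n A)) :
    Integrable fun u : Fin n → ℝ => Complex.exp (toricPhase A P u z) := by
  obtain ⟨r, hr, hint⟩ := exists_integrable_exp_toricPhase hP hz
  refine hint.mono' (Complex.continuous_exp.comp ((continuous_toricPhase
    (nonempty_of_mem_interior_coneA hz) hP).clm_apply continuous_const)).aestronglyMeasurable
    (ae_of_all _ fun u => ?_)
  rw [Complex.norm_exp]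
  gcongr
  have : 0 ≤ r * ‖toricPhase A P u‖ := by positivity
  linarith

lemma cexp_toricPhase_add_toricPoint (hA : A.Nonempty) (hP : ∀ a ∈ A, 0 < P a)
    (u : Fin n → ℝ) (z : ℂ × (Fin n → ℂ)) (a : Fin n → ℤ) :
    Complex.exp (toricPhase A P u (z + toricPoint a)) = Complex.exp (toricPhase A P u z) *
      (Real.exp (∑ i, (a i : ℝ) * u i) / toricSum A P u : ℝ) := by
  rw [map_add, Complex.exp_add]
  congr 1
  have h : toricPhase A P u (toricPoint a) =
      ((∑ i, (a i : ℝ) * u i - Real.log (toricSum A P u) : ℝ) : ℂ) := by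
    rw [toricPhase_apply]
    simp [toricPoint, mul_comm]
  rw [h, ← Complex.ofReal_exp, Real.exp_sub, Real.exp_log (toricSum_pos hA hP u)]

lemma hasLineDerivAt_cexp_toricPhase (hA : A.Nonempty) (hP : ∀ a ∈ A, 0 < P a)
    (w : ℤ × (Fin n → ℤ)) (z : ℂ × (Fin n → ℂ)) (u : Fin n → ℝ) :
    HasLineDerivAt ℝ (fun u => Complex.exp (toricPhase A P u z))
      (toricPairing w z * Complex.exp (toricPhase A P u z) -
        ∑ a ∈ A, z.1 * (toricPairing w (toricPoint a) * P a) *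
          Complex.exp (toricPhase A P u (z + toricPoint a))) u (fun i => (w.2 i : ℝ)) := by
  have hpos := toricSum_pos hA hP u
  have hS : HasDerivAt (fun s : ℝ => toricSum A P (u + s • fun i => (w.2 i : ℝ)))
      (∑ a ∈ A, P a * (Real.exp (∑ i, (a i : ℝ) * u i) * ∑ i, (a i : ℝ) * w.2 i)) 0 := by
    refine HasDerivAt.fun_sum fun a _ => HasDerivAt.const_mul _ ?_
    have h : HasDerivAt (fun s : ℝ => ∑ i, (a i : ℝ) * (u + s • fun i => (w.2 i : ℝ)) i)
        (∑ i, (a i : ℝ) * w.2 i) 0 := by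
      refine HasDerivAt.fun_sum fun i _ => HasDerivAt.const_mul _ ?_
      simpa using ((hasDerivAt_id (0 : ℝ)).mul_const (w.2 i : ℝ)).const_add (u i)
    simpa using h.exp
  have hlog := (hS.log (by simpa using hpos.ne')).ofReal_comp
  have hlin : HasDerivAt (fun s : ℝ => ∑ i, (((u + s • fun i => (w.2 i : ℝ)) i : ℝ) : ℂ) * z.2 i)
      (∑ i, (w.2 i : ℂ) * z.2 i) 0 := by
    refine HasDerivAt.fun_sum fun i _ => HasDerivAt.mul_const ?_ _
    have h := (((hasDerivAt_id (0 : ℝ)).mul_const (w.2 i : ℝ)).const_add (u i)).ofReal_comp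
    simpa using h
  have hexp := (hlin.sub (hlog.mul_const z.1)).cexp
  unfold HasLineDerivAt
  simp only [toricPhase_apply]
  refine hexp.congr_deriv ?_
  simp only [zero_smul, add_zero, ← toricPhase_apply, cexp_toricPhase_add_toricPoint hA hP,
    Pi.sub_apply]
  set S' := ∑ a ∈ A, P a * (Real.exp (∑ i, (a i : ℝ) * u i) * ∑ i, (a i : ℝ) * w.2 i) with hS'
  set T := Complex.exp (toricPhase A P u z)
  have hreal : ∑ a ∈ A, ((w.1 + ∑ i, w.2 i * a i : ℤ) : ℝ) * P a *
      (Real.exp (∑ i, (a i : ℝ) * u i) / toricSum A P u) = w.1 + S' / toricSum A P u := by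
    have h : (w.1 : ℝ) = (∑ a ∈ A, w.1 * (P a * Real.exp (∑ i, (a i : ℝ) * u i))) /
        toricSum A P u := by
      rw [← Finset.mul_sum, ← toricSum, mul_div_cancel_right₀ _ hpos.ne']
    rw [h, hS', ← add_div, ← Finset.sum_add_distrib, Finset.sum_div]
    refine Finset.sum_congr rfl fun a _ => ?_
    have hcomm : ∑ i, (w.2 i : ℝ) * a i = ∑ i, (a i : ℝ) * w.2 i :=
      Finset.sum_congr rfl fun i _ => mul_comm _ _
    push_cast
    rw [hcomm]
    ring
  have hcomplex : ∑ a ∈ A, z.1 * (toricPairing w (toricPoint a) * P a) *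
      (T * (Real.exp (∑ i, (a i : ℝ) * u i) / toricSum A P u : ℝ)) =
        z.1 * T * ((w.1 + S' / toricSum A P u : ℝ) : ℂ) := by
    rw [← hreal, Complex.ofReal_sum, Finset.mul_sum]
    refine Finset.sum_congr rfl fun a _ => ?_
    rw [toricPairing_toricPoint]
    push_cast
    ring
  rw [hcomplex, toricPairing_apply]
  push_cast
  ring

lemma toricPairing_mul_integral (hP : ∀ a ∈ A, 0 < P a) (w : ℤ × (Fin n → ℤ))
    {z : ℂ × (Fin n → ℂ)}
    (hA : A.Nonempty) (hz : Integrable fun u => Complex.exp (toricPhase A P u z))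
    (hza : ∀ a ∈ A, Integrable fun u => Complex.exp (toricPhase A P u (z + toricPoint a))) :
    toricPairing w z * ∫ u, Complex.exp (toricPhase A P u z) =
      ∑ a ∈ A, z.1 * (toricPairing w (toricPoint a) * P a) *
        ∫ u, Complex.exp (toricPhase A P u (z + toricPoint a)) := by
  have hsum : ∀ a ∈ A, Integrable fun u => z.1 * (toricPairing w (toricPoint a) * P a) *
      Complex.exp (toricPhase A P u (z + toricPoint a)) := fun a ha => (hza a ha).const_mul _
  have hzero := integral_bilinear_hasLineDerivAt_right_eq_neg_left_of_integrable
    (μ := (volume : Measure (Fin n → ℝ))) (B := ContinuousLinearMap.mul ℝ ℂ)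
    (f := fun _ => 1) (f' := fun _ => 0) (v := fun i => (w.2 i : ℝ)) (by simp)
    (by
      simp only [ContinuousLinearMap.mul_apply', one_mul]
      exact (hz.const_mul (toricPairing w z)).sub (integrable_finsetSum _ hsum))
    (by simpa using hz)
    (fun u _ => by simpa using (hasFDerivAt_const (1 : ℂ) u).hasLineDerivAt _)
    (fun u _ => hasLineDerivAt_cexp_toricPhase hA hP w z u)
  simp only [ContinuousLinearMap.mul_apply', one_mul, zero_mul, integral_zero, neg_zero] at hzero
  rw [integral_sub (hz.const_mul _) (integrable_finsetSum _ hsum), integral_const_mul,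
    integral_finsetSum _ hsum, sub_eq_zero] at hzero
  simpa only [integral_const_mul] using hzero

lemma mem_interior_coneA_iff {W : Finset (ℤ × (Fin n → ℤ))}
    (hW : ∀ x : ℝ × (Fin n → ℝ), x ∈ coneA n A ↔
      ∀ w ∈ W, 0 ≤ (w.1 : ℝ) * x.1 + ∑ i, (w.2 i : ℝ) * x.2 i)
    (h0 : 0 ∉ W) (x : ℝ × (Fin n → ℝ)) :
    x ∈ interior (coneA n A) ↔ ∀ w ∈ W, 0 < (w.1 : ℝ) * x.1 + ∑ i, (w.2 i : ℝ) * x.2 i := by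
  constructor
  · intro hx w hw
    obtain ⟨ε, hε, hadd⟩ := exists_add_mem_of_mem_interior hx
    set v : ℝ × (Fin n → ℝ) := (w.1, fun i => (w.2 i : ℝ)) with hv
    have hvpos : 0 < (w.1 : ℝ) * w.1 + ∑ i, (w.2 i : ℝ) * w.2 i := by
      have hsq : ∀ i ∈ Finset.univ, 0 ≤ (w.2 i : ℝ) * w.2 i := fun i _ => mul_self_nonneg _
      refine lt_of_le_of_ne (add_nonneg (mul_self_nonneg _) (Finset.sum_nonneg hsq)) fun h => ?_
      have h12 := (add_eq_zero_iff_of_nonneg (mul_self_nonneg (w.1 : ℝ))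
        (Finset.sum_nonneg hsq)).1 h.symm
      have h2 := (Finset.sum_eq_zero_iff_of_nonneg hsq).1 h12.2
      refine h0 ((Prod.ext ?_ (funext fun i => ?_) : w = 0) ▸ hw)
      · simpa using h12.1
      · simpa using h2 i (Finset.mem_univ i)
    have hnorm : 0 < ‖v‖ := by
      rw [norm_pos_iff]
      intro h
      have h1 := congrArg Prod.fst h
      have h2 := fun i => congrFun (congrArg Prod.snd h) i
      simp only [hv, Prod.fst_zero, Prod.snd_zero, Pi.zero_apply] at h1 h2
      simp [h1, h2] at hvpos
    have hmem := (hW _).1 (hadd (-(ε / ‖v‖) • v) (by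
      rw [norm_smul, norm_neg, Real.norm_eq_abs, abs_of_pos (by positivity),
        div_mul_cancel₀ _ hnorm.ne'])) w hw
    have heq : (w.1 : ℝ) * (x + -(ε / ‖v‖) • v).1 + ∑ i, (w.2 i : ℝ) * (x + -(ε / ‖v‖) • v).2 i =
        ((w.1 : ℝ) * x.1 + ∑ i, (w.2 i : ℝ) * x.2 i) -
          (ε / ‖v‖) * ((w.1 : ℝ) * w.1 + ∑ i, (w.2 i : ℝ) * w.2 i) := by
      have hs : ∑ i, (w.2 i : ℝ) * (x + -(ε / ‖v‖) • v).2 i =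
          ∑ i, (w.2 i : ℝ) * x.2 i - (ε / ‖v‖) * ∑ i, (w.2 i : ℝ) * w.2 i := by
        rw [Finset.mul_sum, ← Finset.sum_sub_distrib]
        refine Finset.sum_congr rfl fun i _ => ?_
        simp only [Prod.snd_add, Prod.smul_snd, Pi.add_apply, Pi.smul_apply, smul_eq_mul, hv]
        ring
      rw [hs]
      simp only [Prod.fst_add, Prod.smul_fst, smul_eq_mul, hv]
      ring
    rw [heq] at hmem
    have : 0 < (ε / ‖v‖) * ((w.1 : ℝ) * w.1 + ∑ i, (w.2 i : ℝ) * w.2 i) := by positivity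
    linarith
  · intro hx
    have hopen : IsOpen {x : ℝ × (Fin n → ℝ) |
        ∀ w ∈ W, 0 < (w.1 : ℝ) * x.1 + ∑ i, (w.2 i : ℝ) * x.2 i} := by
      simp only [Set.ofPred_forall]
      exact isOpen_biInter_finset fun w _ => isOpen_lt continuous_const (by fun_prop)
    exact interior_maximal (fun y hy => (hW y).2 fun w hw => (hy w hw).le) hopen hx

lemma isClosed_poleSet (W : Finset (ℤ × (Fin n → ℤ))) : IsClosed (poleSet n A W) := by
  have h : poleSet n A W = ⋃ w ∈ W, toricPairing w ⁻¹' ((fun k : ℤ => (k : ℂ)) ''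
      {k | ∃ m ∈ AddSubmonoid.closure ((fun a : Fin n → ℤ => ((1 : ℤ), a)) '' (A : Set (Fin n → ℤ))),
        k = -(w.1 * m.1 + ∑ i, w.2 i * m.2 i)}) := by
    ext z
    simp only [poleSet, Set.mem_ofPred_eq, Set.mem_iUnion, Set.mem_preimage, Set.mem_image,
      toricPairing_apply, exists_prop]
    refine exists_congr fun w => and_congr_right fun _ => ⟨?_, ?_⟩
    · rintro ⟨m, hm, h⟩
      exact ⟨_, ⟨m, hm, rfl⟩, by rw [h, Int.cast_neg]⟩
    · rintro ⟨_, ⟨m, hm, rfl⟩, h⟩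
      exact ⟨m, hm, by rw [← h, Int.cast_neg]⟩
  rw [h]
  exact W.finite_toSet.isClosed_biUnion fun w _ =>
    (Complex.isClosedEmbedding_intCast.isClosedMap _ (isClosed_discrete _)).preimage
      (toricPairing w).continuous

lemma mem_poleSet_of_toricPairing_eq_zero {W : Finset (ℤ × (Fin n → ℤ))}
    {w : ℤ × (Fin n → ℤ)} (hw : w ∈ W) {z : ℂ × (Fin n → ℂ)} (h : toricPairing w z = 0) :
    z ∈ poleSet n A W :=
  ⟨w, hw, 0, zero_mem _, by rw [← toricPairing_apply, h]; simp⟩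

lemma mem_poleSet_of_add_toricPoint_mem {W : Finset (ℤ × (Fin n → ℤ))} {a : Fin n → ℤ}
    (ha : a ∈ A) {z : ℂ × (Fin n → ℂ)} (h : z + toricPoint a ∈ poleSet n A W) :
    z ∈ poleSet n A W := by
  obtain ⟨w, hw, m, hm, h⟩ := h
  refine ⟨w, hw, m + (1, a), add_mem hm (AddSubmonoid.subset_closure ⟨a, ha, rfl⟩), ?_⟩
  rw [← toricPairing_apply, map_add, toricPairing_toricPoint] at h
  rw [← toricPairing_apply, eq_sub_of_add_eq h]
  simp only [Prod.fst_add, Prod.snd_add, Pi.add_apply, mul_add, Finset.sum_add_distrib]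
  push_cast
  ring

lemma analyticAt_Gamma_of_re_pos {s : ℂ} (hs : 0 < s.re) : AnalyticAt ℂ Complex.Gamma s := by
  have hopen : IsOpen {s : ℂ | 0 < s.re} := isOpen_lt continuous_const Complex.continuous_re
  refine DifferentiableOn.analyticAt (s := {s : ℂ | 0 < s.re}) (fun t ht => ?_)
    (hopen.mem_nhds hs)
  refine (Complex.differentiableAt_Gamma t fun m hm => ?_).differentiableWithinAt
  rw [Set.mem_ofPred_eq, hm, Complex.neg_re, Complex.natCast_re] at ht
  have : (0 : ℝ) ≤ m := m.cast_nonneg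
  linarith

lemma coneA_point_mem {a : Fin n → ℤ} (ha : a ∈ A) :
    (((1 : ℝ), fun i => (a i : ℝ)) : ℝ × (Fin n → ℝ)) ∈ coneA n A := by
  classical
  refine ⟨Pi.single a 1, fun b => ?_, ?_⟩
  · by_cases h : b = a
    · subst h
      simp
    · simp [h]
  · rw [Finset.sum_eq_single a (fun b _ hb => by simp [hb]) (fun h => absurd ha h)]
    simp

/-- `Γ(α₀) K(α)` satisfies the contiguity relations on the domain of convergence. -/
lemma isContiguous_Gamma_mul_integral (hP : ∀ a ∈ A, 0 < P a) {W : Finset (ℤ × (Fin n → ℤ))}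
    (hW : ∀ x : ℝ × (Fin n → ℝ), x ∈ coneA n A ↔
      ∀ w ∈ W, 0 ≤ (w.1 : ℝ) * x.1 + ∑ i, (w.2 i : ℝ) * x.2 i)
    (hmem : ∀ z : ℂ × (Fin n → ℂ), z ∈ shiftedTube (fun w : W => toricPairing w.1) 0 ↔
      ((z.1.re, fun i => (z.2 i).re) : ℝ × (Fin n → ℝ)) ∈ interior (coneA n A)) :
    IsContiguous (fun w : W => toricPairing w.1) A toricPoint (fun a => (P a : ℂ))
      (poleSet n A W) 0
      (fun z => Complex.Gamma z.1 * ∫ u, Complex.exp (toricPhase A P u z)) where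
  analytic := by
    intro z hz
    have hz' := (hmem z).1 hz.1
    obtain ⟨r, hr, hint⟩ := exists_integrable_exp_toricPhase hP hz'
    exact (AnalyticAt.fun_comp (g := Complex.Gamma) (f := Prod.fst)
      (analyticAt_Gamma_of_re_pos (fst_pos_of_mem_interior_coneA hz')) analyticAt_fst).mul
      (analyticAt_integral_cexp (continuous_toricPhase (nonempty_of_mem_interior_coneA hz')
        hP).aestronglyMeasurable hr hint)
  contiguity := by
    intro z hz w
    have hz' := (hmem z).1 hz.1
    have hfst : z.1 ≠ 0 := by
      intro h
      have := fst_pos_of_mem_interior_coneA hz'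
      simp [h] at this
    have hza : ∀ a ∈ A, z + toricPoint a ∈ shiftedTube (fun w : W => toricPairing w.1) 0 := by
      intro a ha w
      have h1 := hz.1 w
      have h2 := (hW _).1 (coneA_point_mem ha) w.1 w.2
      simp only [map_add, Complex.add_re, re_toricPairing w.1 (toricPoint a)]
      simp only [toricPoint, Complex.one_re, Complex.intCast_re]
      linarith
    rw [mul_left_comm, toricPairing_mul_integral hP w.1 (nonempty_of_mem_interior_coneA hz')
      (integrable_cexp_toricPhase hP hz')
      fun a ha => integrable_cexp_toricPhase hP ((hmem _).1 (hza a ha)), Finset.mul_sum]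
    refine Finset.sum_congr rfl fun a _ => ?_
    have hGamma : Complex.Gamma (z + toricPoint a).1 = z.1 * Complex.Gamma z.1 :=
      Complex.Gamma_add_one z.1 hfst
    rw [hGamma]
    ring

end Toric

/-- Degree-one vanishing: the meromorphic continuation of `K(α)` vanishes (away from
its poles) whenever `α₀ ∈ ℤ_{≤0}`. -/
theorem toric_continuation_vanishing (n : ℕ) (A : Finset (Fin n → ℤ))
    (P : (Fin n → ℤ) → ℝ) (hP : ∀ a ∈ A, 0 < P a)
    (W : Finset (ℤ × (Fin n → ℤ)))
    (hW : ∀ x : ℝ × (Fin n → ℝ), x ∈ coneA n A ↔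
      ∀ w ∈ W, 0 ≤ (w.1 : ℝ) * x.1 + ∑ i, (w.2 i : ℝ) * x.2 i) :
    ∃ G : ℂ × (Fin n → ℂ) → ℂ,
      AnalyticOnNhd ℂ G (poleSet n A W)ᶜ ∧
      (∀ (α0 : ℂ) (α : Fin n → ℂ),
        ((α0.re, fun i => (α i).re) : ℝ × (Fin n → ℝ)) ∈ interior (coneA n A) →
        G (α0, α) = Kint n A P α0 α) ∧
      (∀ (α0 : ℂ) (α : Fin n → ℂ), (α0, α) ∉ poleSet n A W →
        (∃ k : ℕ, α0 = -(k : ℂ)) → G (α0, α) = 0) := by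
  by_cases h0 : (0 : ℤ × (Fin n → ℤ)) ∈ W
  · have huniv : ∀ z, z ∈ poleSet n A W := fun z =>
      mem_poleSet_of_toricPairing_eq_zero h0 (by simp [toricPairing_apply])
    exact ⟨fun z => Kint n A P z.1 z.2, fun z hz => absurd (huniv z) hz, fun _ _ _ => rfl,
      fun α0 α h => absurd (huniv (α0, α)) h⟩
  have hmem : ∀ z : ℂ × (Fin n → ℂ), z ∈ shiftedTube (fun w : W => toricPairing w.1) 0 ↔
      ((z.1.re, fun i => (z.2 i).re) : ℝ × (Fin n → ℝ)) ∈ interior (coneA n A) := by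
    intro z
    rw [mem_interior_coneA_iff hW h0]
    simp [shiftedTube, re_toricPairing]
  have hnonneg : ∀ w : W, ∀ a ∈ A, 0 ≤ w.1.1 + ∑ i, w.1.2 i * a i := by
    intro w a ha
    have h := (hW _).1 (coneA_point_mem ha) w.1 w.2
    simp only [mul_one] at h
    exact_mod_cast h
  obtain ⟨G, hG, hGeq⟩ := (isContiguous_Gamma_mul_integral hP hW hmem).exists_continuation
    (d := fun w a => (w.1.1 + ∑ i, w.1.2 i * a i).toNat)
    (fun w a ha => by
      rw [toricPairing_toricPoint, ← Int.cast_natCast, Int.toNat_of_nonneg (hnonneg w a ha)])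
    (isClosed_poleSet W) (fun w _ h => mem_poleSet_of_toricPairing_eq_zero w.2 h)
    (fun _ ha _ h => mem_poleSet_of_add_toricPoint_mem ha h)
  refine ⟨fun z => G z * (Complex.Gamma z.1)⁻¹, fun z hz => (hG z hz).mul ?_, ?_, ?_⟩
  · exact AnalyticAt.fun_comp (g := fun s => (Complex.Gamma s)⁻¹) (f := Prod.fst)
      (Complex.differentiable_one_div_Gamma.analyticAt z.1) analyticAt_fst
  · intro α0 α hα
    have hre : 0 < α0.re := fst_pos_of_mem_interior_coneA hα
    have hne := Complex.Gamma_ne_zero_of_re_pos hre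
    rw [Kint_eq_integral_cexp (nonempty_of_mem_interior_coneA hα) hP (α0, α)]
    simp only
    rw [hGeq ((hmem (α0, α)).2 hα)]
    field_simp
  · rintro α0 α - ⟨k, rfl⟩
    simp [Complex.Gamma_neg_nat_eq_zero]
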